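/- Assume Ĉ := Ĉ(U¹,…,U^J) is invertible and that π̂ is positive and differentiable at U^i. Define F: ℝ^d → ℝ^{d×d} by F(u) := ∑_{j=1}^J ω^{ij}(u)(V^j − μ(u))(V^j − μ(u))ᵀ with μ(u) := ∑_{j=1}^J ω^{ij}(u) V^j, i.e., the localized sample covariance as a function of the position u of the i-th particle. Then the divergence of F at u = U^i, the vector whose ℓ-th component is ∑_{m=1}^d ∂_{u_m} F_{ℓm}(U^i), equals ω^{ii}(d+1)(U^i − Ū^{(i)}) + (1/λ) ∑_{j=1}^J ω^{ij} ((U^j−Ū^{(i)})ᵀĈ⁻¹(U^j−Ū^{(i)})) (U^j−Ū^{(i)}) − (1/(λJ)) Ĉ_w Ĉ⁻¹ ((U^i−Ū^{(i)})(U^i−Ū^{(i)})ᵀ + Ĉ_w) Ĉ⁻¹ (U^i−Ū) + (1/(λJ)) ∑_{j=1}^J ω^{ij} ((U^j−Ū^{(i)})ᵀĈ⁻¹(U^j−U^i)) ((U^i−Ū)ᵀĈ⁻¹(U^j−U^i)) (U^j−Ū^{(i)}) + α ω^{ii} ((U^i−Ū^{(i)})(U^i−Ū^{(i)})ᵀ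 − Ĉ_w) ∇π̂(U^i)/π̂(U^i). -/

import Mathlib

open Matrix

noncomputable section

/-- Sample mean `Ū := (1/J)∑ⱼ Uʲ` of an ensemble of `J` particles in `ℝ^d`. -/
def sMean {d J : ℕ} (U : Fin J → Fin d → ℝ) : Fin d → ℝ :=
  (J : ℝ)⁻¹ • ∑ j, U j

/-- Sample covariance `Ĉ(U¹,…,U^J) := (1/J)∑ⱼ (Uʲ−Ū)(Uʲ−Ū)ᵀ`. -/
def sCov {d J : ℕ} (U : Fin J → Fin d → ℝ) : Matrix (Fin d) (Fin d) ℝ :=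
  (J : ℝ)⁻¹ • ∑ j, vecMulVec (U j - sMean U) (U j - sMean U)

/-- Unnormalized localized weight as a function of the position `u` of the `i`-th
particle: `w^{ik}(u) = exp(−(1/(2λ))(u−Vᵏ)ᵀĈ^{(i)}(u)⁻¹(u−Vᵏ)) π̂(Vᵏ)^α` where
`Vᵏ = Uᵏ` for `k ≠ i` and `Vⁱ = u`. -/
def wgtFun {d J : ℕ} (l α : ℝ) (pih : (Fin d → ℝ) → ℝ) (U : Fin J → Fin d → ℝ)
    (i k : Fin J) (u : Fin d → ℝ) : ℝ :=
  Real.exp (-(1 / (2 * l)) * ((u - Function.update U i u k) ⬝ᵥ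
      ((sCov (Function.update U i u))⁻¹ *ᵥ (u - Function.update U i u k)))) *
    pih (Function.update U i u k) ^ α

/-- Normalized localized weight `ω^{ik}(u) = w^{ik}(u)/∑_{k'} w^{ik'}(u)`. -/
def omgFun {d J : ℕ} (l α : ℝ) (pih : (Fin d → ℝ) → ℝ) (U : Fin J → Fin d → ℝ)
    (i k : Fin J) (u : Fin d → ℝ) : ℝ :=
  wgtFun l α pih U i k u / ∑ k', wgtFun l α pih U i k' u

/-- `ω^{ik} := ω^{ik}(Uⁱ)`. -/
def omg {d J : ℕ} (l α : ℝ) (pih : (Fin d → ℝ) → ℝ) (U : Fin J → Fin d → ℝ)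
    (i k : Fin J) : ℝ :=
  omgFun l α pih U i k (U i)

/-- Localized mean `Ū^{(i)} := ∑ⱼ ω^{ij} Uʲ`. -/
def locM {d J : ℕ} (l α : ℝ) (pih : (Fin d → ℝ) → ℝ) (U : Fin J → Fin d → ℝ)
    (i : Fin J) : Fin d → ℝ :=
  ∑ j, omg l α pih U i j • U j

/-- Localized sample covariance `Ĉ_w := ∑ⱼ ω^{ij}(Uʲ−Ū^{(i)})(Uʲ−Ū^{(i)})ᵀ`. -/
def locC {d J : ℕ} (l α : ℝ) (pih : (Fin d → ℝ) → ℝ) (U : Fin J → Fin d → ℝ)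
    (i : Fin J) : Matrix (Fin d) (Fin d) ℝ :=
  ∑ j, omg l α pih U i j •
    vecMulVec (U j - locM l α pih U i) (U j - locM l α pih U i)

/-- The localized mean `μ(u) = ∑ⱼ ω^{ij}(u) Vʲ` as a function of `u`. -/
def locMFun {d J : ℕ} (l α : ℝ) (pih : (Fin d → ℝ) → ℝ) (U : Fin J → Fin d → ℝ)
    (i : Fin J) (u : Fin d → ℝ) : Fin d → ℝ :=
  ∑ j, omgFun l α pih U i j u • Function.update U i u j

/-- The localized sample covariance
`F(u) = ∑ⱼ ω^{ij}(u)(Vʲ−μ(u))(Vʲ−μ(u))ᵀ` as a function of the position `u` of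
the `i`-th particle. -/
def locCFun {d J : ℕ} (l α : ℝ) (pih : (Fin d → ℝ) → ℝ) (U : Fin J → Fin d → ℝ)
    (i : Fin J) (u : Fin d → ℝ) : Matrix (Fin d) (Fin d) ℝ :=
  ∑ j, omgFun l α pih U i j u •
    vecMulVec (Function.update U i u j - locMFun l α pih U i u)
      (Function.update U i u j - locMFun l α pih U i u)

section Calculus

variable {E : Type*} [NormedAddCommGroup E] [NormedSpace ℝ E] {x : E}

theorem DifferentiableAt.matrix_det {n : Type*} [Fintype n] [DecidableEq n]
    {A : E → Matrix n n ℝ} (hA : ∀ a b, DifferentiableAt ℝ (fun u => A u a b) x) :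
    DifferentiableAt ℝ (fun u => (A u).det) x := by
  simp only [Matrix.det_apply']
  fun_prop

theorem DifferentiableAt.matrix_inv_apply {n : Type*} [Fintype n] [DecidableEq n]
    {A : E → Matrix n n ℝ} (hA : ∀ a b, DifferentiableAt ℝ (fun u => A u a b) x)
    (hdet : (A x).det ≠ 0) (a b : n) :
    DifferentiableAt ℝ (fun u => (A u)⁻¹ a b) x := by
  simp only [Matrix.inv_def, Matrix.smul_apply, Ring.inverse_eq_inv', smul_eq_mul,
    Matrix.adjugate_apply]
  refine ((DifferentiableAt.matrix_det hA).inv hdet).mul (DifferentiableAt.matrix_det ?_)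
  intro c e
  simp only [Matrix.updateRow_apply]
  split_ifs
  · exact differentiableAt_const _
  · exact hA c e

theorem fderiv_matrix_inv_apply {n : Type*} [Fintype n] [DecidableEq n]
    {A : E → Matrix n n ℝ} {A' : n → n → E →L[ℝ] ℝ}
    (hA : ∀ a b, HasFDerivAt (fun u => A u a b) (A' a b) x)
    (hdet : (A x).det ≠ 0) (v : E) :
    (Matrix.of fun a b => fderiv ℝ (fun u => (A u)⁻¹ a b) x v) =
      -((A x)⁻¹ * (Matrix.of fun a b => A' a b v) * (A x)⁻¹) := by
  have hdiff := fun a b => (hA a b).differentiableAt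
  have hunit : ∀ᶠ u in nhds x, (A u).det ≠ 0 :=
    (DifferentiableAt.matrix_det hdiff).continuousAt.eventually_ne hdet
  have key : (Matrix.of fun a b => fderiv ℝ (fun u => (A u)⁻¹ a b) x v) * A x +
      (A x)⁻¹ * (Matrix.of fun a b => A' a b v) = 0 := by
    ext a b
    have h1 : HasFDerivAt (fun u => ∑ c, (A u)⁻¹ a c * A u c b)
        (∑ c, ((A x)⁻¹ a c • A' c b + A x c b • fderiv ℝ (fun u => (A u)⁻¹ a c) x)) x :=
      HasFDerivAt.fun_sum fun c _ =>
        (DifferentiableAt.matrix_inv_apply hdiff hdet a c).hasFDerivAt.mul (hA c b)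
    have h2 : HasFDerivAt (fun u => ∑ c, (A u)⁻¹ a c * A u c b) (0 : E →L[ℝ] ℝ) x := by
      refine (hasFDerivAt_const ((1 : Matrix n n ℝ) a b) x).congr_of_eventuallyEq ?_
      filter_upwards [hunit] with u hu
      rw [← Matrix.mul_apply, Matrix.nonsing_inv_mul _ (isUnit_iff_ne_zero.2 hu)]
    have h3 := congrArg (fun L : E →L[ℝ] ℝ => L v) (h1.unique h2)
    simp only [_root_.sum_apply, _root_.add_apply,
      _root_.smul_apply, smul_eq_mul, _root_.zero_apply] at h3
    simp only [Matrix.add_apply, Matrix.mul_apply, Matrix.of_apply, Matrix.zero_apply,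
      ← Finset.sum_add_distrib]
    rw [← h3]
    exact Finset.sum_congr rfl fun c _ => by ring
  have hu := isUnit_iff_ne_zero.2 hdet
  rw [← Matrix.neg_mul, ← eq_neg_of_add_eq_zero_left key, Matrix.mul_assoc,
    Matrix.mul_nonsing_inv _ hu, Matrix.mul_one]

theorem hasFDerivAt_dotProduct_inv_mulVec {n : Type*} [Fintype n] [DecidableEq n]
    {A : E → Matrix n n ℝ} {A' : n → n → E →L[ℝ] ℝ} {y : E → n → ℝ} {y' : n → E →L[ℝ] ℝ}
    {L : E →L[ℝ] ℝ}
    (hA : ∀ a b, HasFDerivAt (fun u => A u a b) (A' a b) x)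
    (hy : ∀ a, HasFDerivAt (fun u => y u a) (y' a) x)
    (hdet : (A x).det ≠ 0) (hsymm : (A x).IsSymm)
    (hL : ∀ v, L v = 2 * (((A x)⁻¹ *ᵥ y x) ⬝ᵥ fun a => y' a v) -
      ((A x)⁻¹ *ᵥ y x) ⬝ᵥ ((Matrix.of fun a b => A' a b v) *ᵥ ((A x)⁻¹ *ᵥ y x))) :
    HasFDerivAt (fun u => y u ⬝ᵥ ((A u)⁻¹ *ᵥ y u)) L x := by
  have hB := fun a b =>
    (DifferentiableAt.matrix_inv_apply (fun a b => (hA a b).differentiableAt) hdet a b).hasFDerivAt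
  have h : HasFDerivAt (fun u => ∑ a, y u a * ∑ b, (A u)⁻¹ a b * y u b) _ x :=
    HasFDerivAt.fun_sum fun a _ =>
      (hy a).mul (HasFDerivAt.fun_sum fun b _ => (hB a b).mul (hy b))
  refine h.congr_fderiv ?_
  ext v
  have hinv : ((A x)⁻¹)ᵀ = (A x)⁻¹ := by rw [Matrix.transpose_nonsing_inv, hsymm.eq]
  have hvec : ∀ z, z ᵥ* (A x)⁻¹ = (A x)⁻¹ *ᵥ z := fun z => by
    rw [← Matrix.mulVec_transpose, hinv]
  have hBv := fderiv_matrix_inv_apply hA hdet v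
  trans (y x ⬝ᵥ ((Matrix.of fun a b => fderiv ℝ (fun u => (A u)⁻¹ a b) x v) *ᵥ y x) +
    y x ⬝ᵥ ((A x)⁻¹ *ᵥ fun a => y' a v)) + (fun a => y' a v) ⬝ᵥ ((A x)⁻¹ *ᵥ y x)
  · simp only [_root_.sum_apply, _root_.add_apply,
      _root_.smul_apply, smul_eq_mul, dotProduct, mulVec, Matrix.of_apply,
      Finset.sum_add_distrib, mul_add, Finset.mul_sum, Finset.sum_mul]
    rw [add_comm (∑ a, ∑ b, y x a * ((A x)⁻¹ a b * (y' b) v))]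
    congr 1
    · congr 1
      refine Finset.sum_congr rfl fun a _ => Finset.sum_congr rfl fun b _ => by ring
    · refine Finset.sum_congr rfl fun a _ => Finset.sum_congr rfl fun b _ => by ring
  · rw [hBv, hL, Matrix.neg_mulVec, dotProduct_neg, ← Matrix.mulVec_mulVec,
      ← Matrix.mulVec_mulVec, Matrix.dotProduct_mulVec (y x), hvec,
      Matrix.dotProduct_mulVec (y x), hvec, dotProduct_comm (fun a => y' a v)]
    ring

theorem hasFDerivAt_weightedCov {ι : Type*} [Fintype ι] {w f g : ι → E → ℝ}
    {w' f' g' : ι → E →L[ℝ] ℝ} (hw : ∀ j, HasFDerivAt (w j) (w' j) x)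
    (hf : ∀ j, HasFDerivAt (f j) (f' j) x) (hg : ∀ j, HasFDerivAt (g j) (g' j) x)
    (hsum : ∑ j, w j x = 1) :
    HasFDerivAt (fun u => ∑ j, w j u *
        ((f j u - ∑ k, w k u * f k u) * (g j u - ∑ k, w k u * g k u)))
      (∑ j, (((f j x - ∑ k, w k x * f k x) * (g j x - ∑ k, w k x * g k x)) • w' j +
        w j x • ((g j x - ∑ k, w k x * g k x) • f' j +
          (f j x - ∑ k, w k x * f k x) • g' j))) x := by
  have hcentre : ∀ h : ι → E → ℝ, ∑ j, w j x * (h j x - ∑ k, w k x * h k x) = 0 := by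
    intro h
    simp only [mul_sub, Finset.sum_sub_distrib, ← Finset.sum_mul, hsum]
    ring
  have hmean : ∀ {h : ι → E → ℝ} {h' : ι → E →L[ℝ] ℝ}, (∀ j, HasFDerivAt (h j) (h' j) x) →
      HasFDerivAt (fun u => ∑ k, w k u * h k u) (∑ k, (w k x • h' k + h k x • w' k)) x :=
    fun hh => HasFDerivAt.fun_sum fun k _ => (hw k).mul (hh k)
  have hmf := hmean hf
  have hmg := hmean hg
  have hcf := hcentre f
  have hcg := hcentre g
  generalize ∑ k, (w k x • f' k + f k x • w' k) = mf' at hmf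
  generalize ∑ k, (w k x • g' k + g k x • w' k) = mg' at hmg
  refine (HasFDerivAt.fun_sum fun j _ =>
    (hw j).mul (((hf j).sub hmf).mul ((hg j).sub hmg))).congr_fderiv ?_
  ext v
  simp only [_root_.sum_apply, _root_.add_apply,
      _root_.smul_apply, smul_eq_mul, _root_.sub_apply, Pi.sub_apply, Pi.mul_apply]
  rw [← sub_eq_zero, ← Finset.sum_sub_distrib]
  trans ∑ j, (-(w j x * (f j x - ∑ k, w k x * f k x)) * mg' v -
    (w j x * (g j x - ∑ k, w k x * g k x)) * mf' v)
  · exact Finset.sum_congr rfl fun j _ => by ring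
  · rw [Finset.sum_sub_distrib, ← Finset.sum_mul, ← Finset.sum_mul, hcg,
      Finset.sum_neg_distrib, hcf]
    ring

theorem hasFDerivAt_normalized {ι : Type*} [Fintype ι] {w : ι → E → ℝ}
    {G : ι → E →L[ℝ] ℝ} (hw : ∀ j, HasFDerivAt (w j) (w j x • G j) x)
    (hsum : ∑ j, w j x ≠ 0) (k : ι) :
    HasFDerivAt (fun u => w k u / ∑ j, w j u)
      ((w k x / ∑ j, w j x) • (G k - ∑ j, (w j x / ∑ j', w j' x) • G j)) x := by
  have hs : HasFDerivAt (fun u => ∑ j, w j u) (∑ j, w j x • G j) x :=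
    HasFDerivAt.fun_sum fun j _ => hw j
  simp only [div_eq_mul_inv (w k _)]
  refine ((hw k).mul ((hasDerivAt_inv hsum).comp_hasFDerivAt x hs)).congr_fderiv ?_
  ext v
  have : ∑ j, (w j x / ∑ j', w j' x) * G j v = (∑ j, w j x * G j v) / ∑ j', w j' x := by
    rw [Finset.sum_div]
    exact Finset.sum_congr rfl fun j _ => by ring
  simp only [_root_.sum_apply, _root_.smul_apply, smul_eq_mul,
    _root_.sub_apply, _root_.add_apply, Function.comp_apply, this]
  field_simp
  ring

end Calculus

section Gradients

variable {d J : ℕ}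

/-- The linear functional `v ↦ g ⬝ᵥ v` as a continuous linear map. -/
def dotProductCLM (g : Fin d → ℝ) : (Fin d → ℝ) →L[ℝ] ℝ :=
  ∑ a, g a • ContinuousLinearMap.proj (R := ℝ) (φ := fun _ : Fin d => ℝ) a

@[simp]
theorem dotProductCLM_apply (g v : Fin d → ℝ) : dotProductCLM g v = g ⬝ᵥ v := by
  simp [dotProductCLM, dotProduct]

theorem hasFDerivAt_update_apply (U : Fin J → Fin d → ℝ) (i j : Fin J) (a : Fin d)
    (x : Fin d → ℝ) :
    HasFDerivAt (fun u => Function.update U i u j a)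
      (if j = i then ContinuousLinearMap.proj (R := ℝ) (φ := fun _ : Fin d => ℝ) a else 0) x := by
  split_ifs with h
  · subst h
    simpa using hasFDerivAt_apply (𝕜 := ℝ) a x
  · simpa [Function.update_of_ne h] using hasFDerivAt_const (U j a) x

theorem sMean_apply (U : Fin J → Fin d → ℝ) (a : Fin d) :
    sMean U a = ∑ j, (J : ℝ)⁻¹ * U j a := by
  simp [sMean, Finset.mul_sum]

theorem sCov_apply (U : Fin J → Fin d → ℝ) (a b : Fin d) :
    sCov U a b = ∑ j, (J : ℝ)⁻¹ * ((U j a - ∑ k, (J : ℝ)⁻¹ * U k a) *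
      (U j b - ∑ k, (J : ℝ)⁻¹ * U k b)) := by
  simp only [sCov, Matrix.smul_apply, Matrix.sum_apply, vecMulVec_apply, Pi.sub_apply,
    sMean_apply, smul_eq_mul]
  rw [Finset.mul_sum]

theorem sCov_isSymm (U : Fin J → Fin d → ℝ) : (sCov U).IsSymm := by
  ext a b
  simp only [Matrix.transpose_apply, sCov_apply]
  exact Finset.sum_congr rfl fun j _ => by ring

theorem hasFDerivAt_sCov_update_apply (hJ : 1 ≤ J) (U : Fin J → Fin d → ℝ) (i : Fin J)
    (a b : Fin d) :
    HasFDerivAt (fun u => sCov (Function.update U i u) a b)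
      ((J : ℝ)⁻¹ • ((U i - sMean U) b •
          ContinuousLinearMap.proj (R := ℝ) (φ := fun _ : Fin d => ℝ) a +
        (U i - sMean U) a • ContinuousLinearMap.proj b)) (U i) := by
  simp only [sCov_apply]
  have hJ' : (J : ℝ) ≠ 0 := by positivity
  refine (hasFDerivAt_weightedCov
    (fun _ : Fin J => hasFDerivAt_const (J : ℝ)⁻¹ (U i))
    (fun j => hasFDerivAt_update_apply U i j a (U i))
    (fun j => hasFDerivAt_update_apply U i j b (U i)) (by simp [hJ'])).congr_fderiv ?_
  simp only [Function.update_eq_self, smul_zero, zero_add, smul_add, smul_ite,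
    Finset.sum_add_distrib, Finset.sum_ite_eq', Finset.mem_univ, if_true,
    Pi.sub_apply, sMean_apply]

/-- The gradient of `u ↦ (u - Vᵏ) ⬝ᵥ Ĉ⁽ⁱ⁾(u)⁻¹ (u - Vᵏ)` at `Uⁱ`. -/
theorem hasFDerivAt_mahalanobis (hJ : 1 ≤ J) (U : Fin J → Fin d → ℝ) (i k : Fin J)
    (hC : IsUnit (sCov U).det) :
    HasFDerivAt (fun u => (u - Function.update U i u k) ⬝ᵥ
        ((sCov (Function.update U i u))⁻¹ *ᵥ (u - Function.update U i u k)))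
      (dotProductCLM ((2 * (1 - (J : ℝ)⁻¹ *
        ((U i - sMean U) ⬝ᵥ ((sCov U)⁻¹ *ᵥ (U i - U k))))) • ((sCov U)⁻¹ *ᵥ (U i - U k))))
      (U i) := by
  refine hasFDerivAt_dotProduct_inv_mulVec
    (A := fun u => sCov (Function.update U i u)) (y := fun u => u - Function.update U i u k)
    (hasFDerivAt_sCov_update_apply hJ U i)
    (fun a => (hasFDerivAt_apply (𝕜 := ℝ) a (U i)).sub (hasFDerivAt_update_apply U i k a (U i)))
    (by simpa using hC.ne_zero) (by simpa using sCov_isSymm U) fun v => ?_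
  simp only [Function.update_eq_self, dotProductCLM_apply]
  have hy : ((sCov U)⁻¹ *ᵥ (U i - U k)) ⬝ᵥ (fun a => (ContinuousLinearMap.proj a -
      if k = i then ContinuousLinearMap.proj a else 0 : (Fin d → ℝ) →L[ℝ] ℝ) v) =
      ((sCov U)⁻¹ *ᵥ (U i - U k)) ⬝ᵥ v := by
    split_ifs with h
    · simp [h]
    · simp [dotProduct]
  have hA : (Matrix.of fun a b => ((J : ℝ)⁻¹ • ((U i - sMean U) b • ContinuousLinearMap.proj a +
        (U i - sMean U) a • ContinuousLinearMap.proj b) : (Fin d → ℝ) →L[ℝ] ℝ) v) =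
      (J : ℝ)⁻¹ • (vecMulVec v (U i - sMean U) + vecMulVec (U i - sMean U) v) := by
    ext a b
    simp [vecMulVec_apply]
    ring
  rw [hy, hA]
  generalize (sCov U)⁻¹ *ᵥ (U i - U k) = z
  simp only [Matrix.smul_mulVec, Matrix.add_mulVec, vecMulVec_mulVec, dotProduct_smul,
    dotProduct_add, smul_dotProduct, smul_eq_mul, op_smul_eq_smul]
  rw [dotProduct_comm v z, dotProduct_comm z (U i - sMean U)]
  ring

/-- The gradient of `log w^{ik}` at `Uⁱ`. -/
def logWgtGrad (l α : ℝ) (pih : (Fin d → ℝ) → ℝ) (U : Fin J → Fin d → ℝ)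
    (i k : Fin J) : (Fin d → ℝ) →L[ℝ] ℝ :=
  dotProductCLM ((-l⁻¹ * (1 - (J : ℝ)⁻¹ *
      ((U i - sMean U) ⬝ᵥ ((sCov U)⁻¹ *ᵥ (U i - U k))))) • ((sCov U)⁻¹ *ᵥ (U i - U k))) +
    if k = i then (α * (pih (U i))⁻¹) • fderiv ℝ pih (U i) else 0

theorem wgtFun_pos (l α : ℝ) {pih : (Fin d → ℝ) → ℝ} (hpos : ∀ v, 0 < pih v)
    (U : Fin J → Fin d → ℝ) (i k : Fin J) (u : Fin d → ℝ) : 0 < wgtFun l α pih U i k u :=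
  mul_pos (Real.exp_pos _) (Real.rpow_pos_of_pos (hpos _) _)

theorem hasFDerivAt_wgtFun (hJ : 1 ≤ J) (l α : ℝ) {pih : (Fin d → ℝ) → ℝ}
    (hpos : ∀ v, 0 < pih v) (U : Fin J → Fin d → ℝ) (i k : Fin J)
    (hC : IsUnit (sCov U).det) (hdiff : DifferentiableAt ℝ pih (U i)) :
    HasFDerivAt (wgtFun l α pih U i k)
      (wgtFun l α pih U i k (U i) • logWgtGrad l α pih U i k) (U i) := by
  have hpi : HasFDerivAt (fun u => pih (Function.update U i u k) ^ α)
      (pih (U k) ^ α •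
        if k = i then (α * (pih (U i))⁻¹) • fderiv ℝ pih (U i) else 0) (U i) := by
    split_ifs with h
    · subst h
      simp only [Function.update_self]
      refine (hdiff.hasFDerivAt.rpow_const (Or.inl (hpos _).ne')).congr_fderiv ?_
      rw [smul_smul, Real.rpow_sub_one (hpos _).ne']
      congr 1
      ring
    · simpa [Function.update_of_ne h] using hasFDerivAt_const (pih (U k) ^ α) (U i)
  refine (((hasFDerivAt_mahalanobis hJ U i k hC).const_mul (-(1 / (2 * l)))).exp.mul
    hpi).congr_fderiv ?_
  ext v
  simp only [wgtFun, logWgtGrad, Function.update_eq_self, _root_.add_apply, _root_.smul_apply,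
    dotProductCLM_apply, smul_dotProduct, smul_eq_mul]
  ring

theorem sum_wgtFun_pos (l α : ℝ) {pih : (Fin d → ℝ) → ℝ} (hpos : ∀ v, 0 < pih v)
    (U : Fin J → Fin d → ℝ) (i : Fin J) (u : Fin d → ℝ) :
    0 < ∑ k, wgtFun l α pih U i k u :=
  Finset.sum_pos (fun k _ => wgtFun_pos l α hpos U i k u) ⟨i, Finset.mem_univ i⟩

theorem sum_omg (l α : ℝ) {pih : (Fin d → ℝ) → ℝ} (hpos : ∀ v, 0 < pih v)
    (U : Fin J → Fin d → ℝ) (i : Fin J) : ∑ k, omg l α pih U i k = 1 := by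
  simp only [omg, omgFun, ← Finset.sum_div]
  exact div_self (sum_wgtFun_pos l α hpos U i _).ne'

theorem locM_apply (l α : ℝ) (pih : (Fin d → ℝ) → ℝ) (U : Fin J → Fin d → ℝ) (i : Fin J)
    (a : Fin d) : locM l α pih U i a = ∑ k, omg l α pih U i k * U k a := by
  simp [locM]

theorem locCFun_apply (l α : ℝ) (pih : (Fin d → ℝ) → ℝ) (U : Fin J → Fin d → ℝ) (i : Fin J)
    (u : Fin d → ℝ) (a b : Fin d) :
    locCFun l α pih U i u a b = ∑ j, omgFun l α pih U i j u *
      ((Function.update U i u j a - ∑ k, omgFun l α pih U i k u * Function.update U i u k a) *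
       (Function.update U i u j b -
        ∑ k, omgFun l α pih U i k u * Function.update U i u k b)) := by
  simp [locCFun, locMFun, Matrix.sum_apply, vecMulVec_apply]

theorem hasFDerivAt_locCFun_apply (hJ : 1 ≤ J) (l α : ℝ) {pih : (Fin d → ℝ) → ℝ}
    (hpos : ∀ v, 0 < pih v) (U : Fin J → Fin d → ℝ) (i : Fin J)
    (hC : IsUnit (sCov U).det) (hdiff : DifferentiableAt ℝ pih (U i)) (a b : Fin d) :
    HasFDerivAt (fun u => locCFun l α pih U i u a b)
      (∑ j, (((U j - locM l α pih U i) a * (U j - locM l α pih U i) b) •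
        omg l α pih U i j • (logWgtGrad l α pih U i j -
          ∑ k, omg l α pih U i k • logWgtGrad l α pih U i k)) +
        omg l α pih U i i • ((U i - locM l α pih U i) b • ContinuousLinearMap.proj a +
          (U i - locM l α pih U i) a • ContinuousLinearMap.proj b)) (U i) := by
  simp only [locCFun_apply]
  refine (hasFDerivAt_weightedCov
    (fun j => hasFDerivAt_normalized
      (fun k => hasFDerivAt_wgtFun hJ l α hpos U i k hC hdiff)
      (sum_wgtFun_pos l α hpos U i _).ne' j)
    (fun j => hasFDerivAt_update_apply U i j a (U i))
    (fun j => hasFDerivAt_update_apply U i j b (U i))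
    (sum_omg l α hpos U i)).congr_fderiv ?_
  simp only [Function.update_eq_self, smul_add, smul_ite, smul_zero,
    Finset.sum_add_distrib, Finset.sum_ite_eq', Finset.mem_univ, if_true,
    Pi.sub_apply, locM_apply]
  rfl

end Gradients

section Algebra

variable {d J : ℕ}

theorem sum_smul_vecMulVec_mulVec (w : Fin J → ℝ) (P : Fin J → Fin d → ℝ) (z : Fin d → ℝ) :
    (∑ j, w j • vecMulVec (P j) (P j)) *ᵥ z = ∑ j, (w j * (P j ⬝ᵥ z)) • P j := by
  simp only [Matrix.sum_mulVec, Matrix.smul_mulVec, vecMulVec_mulVec, op_smul_eq_smul, smul_smul]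

theorem sum_smul_vecMulVec_sub (w : Fin J → ℝ) (P : Fin J → Fin d → ℝ) (i : Fin J)
    (hw : ∑ j, w j = 1) (hP : ∑ j, w j • P j = 0) :
    vecMulVec (P i) (P i) + ∑ j, w j • vecMulVec (P j) (P j) =
      ∑ j, w j • vecMulVec (P j - P i) (P j - P i) := by
  ext a b
  have hPa : ∀ a, ∑ j, w j * P j a = 0 := fun a => by
    simpa using congrFun hP a
  simp only [Matrix.add_apply, Matrix.sum_apply, Matrix.smul_apply, vecMulVec_apply,
    smul_eq_mul, Pi.sub_apply]
  trans P i a * P i b * ∑ j, w j + ∑ j, w j * (P j a * P j b) -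
    P i b * ∑ j, w j * P j a - P i a * ∑ j, w j * P j b
  · rw [hw, hPa, hPa]; ring
  · simp only [Finset.mul_sum, ← Finset.sum_add_distrib, ← Finset.sum_sub_distrib]
    exact Finset.sum_congr rfl fun j _ => by ring

theorem sum_score_identity (w : Fin J → ℝ) (P : Fin J → Fin d → ℝ) (i : Fin J)
    (S : Matrix (Fin d) (Fin d) ℝ) (hS : Sᵀ = S) (b n : Fin d → ℝ) (r s c : ℝ)
    (hw : ∑ j, w j = 1) (hP : ∑ j, w j • P j = 0)
    (g : Fin J → Fin d → ℝ)
    (hg : ∀ j, g j = r • (S *ᵥ (P j - P i)) + (s * (b ⬝ᵥ (S *ᵥ (P j - P i)))) •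
      (S *ᵥ (P j - P i)) + if j = i then c • n else 0) :
    ∑ j, (w j * (P j ⬝ᵥ (g j - ∑ k, w k • g k))) • P j =
      r • ∑ j, (w j * (P j ⬝ᵥ (S *ᵥ P j))) • P j -
      s • (((∑ j, w j • vecMulVec (P j) (P j)) * S * (vecMulVec (P i) (P i) +
        ∑ j, w j • vecMulVec (P j) (P j)) * S) *ᵥ b) +
      s • ∑ j, (w j * (P j ⬝ᵥ (S *ᵥ (P j - P i))) * (b ⬝ᵥ (S *ᵥ (P j - P i)))) • P j +
      (c * w i) • ((vecMulVec (P i) (P i) - ∑ j, w j • vecMulVec (P j) (P j)) *ᵥ n) := by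
  have hmean : ∑ k, w k • g k = -(r • (S *ᵥ P i)) +
      s • (S *ᵥ ((vecMulVec (P i) (P i) + ∑ j, w j • vecMulVec (P j) (P j)) *ᵥ (S *ᵥ b))) +
      (c * w i) • n := by
    have hD : ∑ k, w k • (P k - P i) = -P i := by
      simp only [smul_sub, Finset.sum_sub_distrib, hP, ← Finset.sum_smul, hw, one_smul, zero_sub]
    rw [sum_smul_vecMulVec_sub w P i hw hP, sum_smul_vecMulVec_mulVec, Matrix.mulVec_sum,
      ← smul_neg, ← Matrix.mulVec_neg, ← hD, Matrix.mulVec_sum, Finset.smul_sum, Finset.smul_sum]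
    simp only [hg, smul_add, Finset.sum_add_distrib, smul_ite, smul_zero, Finset.sum_ite_eq',
      Finset.mem_univ, if_true, Matrix.mulVec_smul]
    congr 1
    · congr 1
      · exact Finset.sum_congr rfl fun j _ => smul_comm _ _ _
      · refine Finset.sum_congr rfl fun j _ => ?_
        rw [Matrix.dotProduct_mulVec (P j - P i), ← Matrix.mulVec_transpose, hS,
          dotProduct_comm _ b, smul_smul, smul_smul]
        congr 1
        ring
    · rw [smul_smul, mul_comm]
  have hsplit : ∑ j, (w j * (P j ⬝ᵥ (g j - ∑ k, w k • g k))) • P j =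
      ∑ j, (w j * (P j ⬝ᵥ g j)) • P j -
        (∑ j, w j • vecMulVec (P j) (P j)) *ᵥ ∑ k, w k • g k := by
    rw [sum_smul_vecMulVec_mulVec, ← Finset.sum_sub_distrib]
    simp only [dotProduct_sub, mul_sub, sub_smul]
  have hscore : ∑ j, (w j * (P j ⬝ᵥ g j)) • P j =
      r • ∑ j, (w j * (P j ⬝ᵥ (S *ᵥ P j))) • P j -
      r • ((∑ j, w j • vecMulVec (P j) (P j)) *ᵥ (S *ᵥ P i)) +
      s • ∑ j, (w j * (P j ⬝ᵥ (S *ᵥ (P j - P i))) * (b ⬝ᵥ (S *ᵥ (P j - P i)))) • P j +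
      (c * w i) • (vecMulVec (P i) (P i) *ᵥ n) := by
    have hn : (c * w i) • (vecMulVec (P i) (P i) *ᵥ n) =
        ∑ j, if j = i then (w j * (c * (P j ⬝ᵥ n))) • P j else 0 := by
      rw [Finset.sum_ite_eq', if_pos (Finset.mem_univ i), vecMulVec_mulVec, op_smul_eq_smul,
        smul_smul]
      congr 1
      ring
    rw [hn, sum_smul_vecMulVec_mulVec]
    simp only [Finset.smul_sum, ← Finset.sum_sub_distrib, ← Finset.sum_add_distrib]
    refine Finset.sum_congr rfl fun j _ => ?_
    rw [hg]
    split_ifs with h <;>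
    · simp only [dotProduct_add, dotProduct_smul, dotProduct_zero, Matrix.mulVec_sub,
        dotProduct_sub, smul_eq_mul]
      module
  rw [hsplit, hscore, hmean]
  simp only [Matrix.mulVec_add, Matrix.mulVec_neg, Matrix.mulVec_smul, Matrix.sub_mulVec,
    ← Matrix.mulVec_mulVec]
  module

end Algebra

/-- Divergence formula for the localized sample covariance (Lemma 6.1 of the paper):
each entry of `F` is differentiable at `u = Uⁱ`, and the divergence
`(∑ₘ ∂_{uₘ} F_{ℓm}(Uⁱ))_ℓ` equals
`ω^{ii}(d+1)(Uⁱ−Ū^{(i)}) + (1/λ)∑ⱼ ω^{ij}((Uʲ−Ū^{(i)})ᵀĈ⁻¹(Uʲ−Ū^{(i)}))(Uʲ−Ū^{(i)})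
 − (1/(λJ)) Ĉ_w Ĉ⁻¹((Uⁱ−Ū^{(i)})(Uⁱ−Ū^{(i)})ᵀ + Ĉ_w)Ĉ⁻¹(Uⁱ−Ū)
 + (1/(λJ))∑ⱼ ω^{ij}((Uʲ−Ū^{(i)})ᵀĈ⁻¹(Uʲ−Uⁱ))((Uⁱ−Ū)ᵀĈ⁻¹(Uʲ−Uⁱ))(Uʲ−Ū^{(i)})
 + α ω^{ii}((Uⁱ−Ū^{(i)})(Uⁱ−Ū^{(i)})ᵀ − Ĉ_w)∇π̂(Uⁱ)/π̂(Uⁱ)`. -/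
theorem divergence_locCov {d J : ℕ} (hd : 1 ≤ d) (hJ : 1 ≤ J)
    (l α : ℝ) (hl : 0 < l) (hα : 0 ≤ α)
    (pih : (Fin d → ℝ) → ℝ) (hpos : ∀ v, 0 < pih v)
    (U : Fin J → Fin d → ℝ) (i : Fin J) (hC : IsUnit (sCov U).det)
    (hdiff : DifferentiableAt ℝ pih (U i)) :
    (∀ ℓ m : Fin d,
        DifferentiableAt ℝ (fun u => locCFun l α pih U i u ℓ m) (U i)) ∧
      (fun ℓ => ∑ m,
          fderiv ℝ (fun u => locCFun l α pih U i u ℓ m) (U i) (Pi.single m 1)) =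
        (omg l α pih U i i * ((d : ℝ) + 1)) • (U i - locM l α pih U i) +
          l⁻¹ • ∑ j, (omg l α pih U i j *
              ((U j - locM l α pih U i) ⬝ᵥ
                ((sCov U)⁻¹ *ᵥ (U j - locM l α pih U i)))) •
            (U j - locM l α pih U i) -
          (l * (J : ℝ))⁻¹ •
            ((locC l α pih U i * (sCov U)⁻¹ *
                (vecMulVec (U i - locM l α pih U i) (U i - locM l α pih U i) +
                  locC l α pih U i) * (sCov U)⁻¹) *ᵥ (U i - sMean U)) +
          (l * (J : ℝ))⁻¹ • ∑ j, (omg l α pih U i j *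
              ((U j - locM l α pih U i) ⬝ᵥ ((sCov U)⁻¹ *ᵥ (U j - U i))) *
              ((U i - sMean U) ⬝ᵥ ((sCov U)⁻¹ *ᵥ (U j - U i)))) •
            (U j - locM l α pih U i) +
          (α * omg l α pih U i i) •
            ((vecMulVec (U i - locM l α pih U i) (U i - locM l α pih U i) -
                locC l α pih U i) *ᵥ
              ((pih (U i))⁻¹ • fun ℓ => fderiv ℝ pih (U i) (Pi.single ℓ 1))) := by
  have hF := hasFDerivAt_locCFun_apply hJ l α hpos U i hC hdiff
  refine ⟨fun a b => (hF a b).differentiableAt, ?_⟩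
  have hw := sum_omg l α hpos U i
  have hP : ∑ j, omg l α pih U i j • (U j - locM l α pih U i) = 0 := by
    simp only [smul_sub, Finset.sum_sub_distrib, ← Finset.sum_smul, hw, one_smul]
    exact sub_self _
  have hS : ((sCov U)⁻¹)ᵀ = (sCov U)⁻¹ := by
    rw [Matrix.transpose_nonsing_inv, (sCov_isSymm U).eq]
  have key := sum_score_identity (omg l α pih U i) (fun j => U j - locM l α pih U i) i
    (sCov U)⁻¹ hS (U i - sMean U)
    ((pih (U i))⁻¹ • fun ℓ => fderiv ℝ pih (U i) (Pi.single ℓ 1)) l⁻¹ (l * (J : ℝ))⁻¹ α hw hP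
    (fun j m => logWgtGrad l α pih U i j (Pi.single m 1)) (fun j => by
      ext m
      rw [sub_sub_sub_cancel_right, ← neg_sub (U i) (U j)]
      simp only [logWgtGrad, _root_.add_apply, dotProductCLM_apply, dotProduct_single, mul_one,
        Matrix.mulVec_neg, dotProduct_neg, Pi.add_apply, Pi.smul_apply, Pi.neg_apply, smul_eq_mul]
      split_ifs <;> simp <;> ring)
  simp only [sub_sub_sub_cancel_right] at key
  have hdiv : (fun ℓ => ∑ m,
      fderiv ℝ (fun u => locCFun l α pih U i u ℓ m) (U i) (Pi.single m 1)) =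
      (omg l α pih U i i * ((d : ℝ) + 1)) • (U i - locM l α pih U i) +
      ∑ j, (omg l α pih U i j * ((U j - locM l α pih U i) ⬝ᵥ
        ((fun m => logWgtGrad l α pih U i j (Pi.single m 1)) -
          ∑ k, omg l α pih U i k • fun m => logWgtGrad l α pih U i k (Pi.single m 1)))) •
        (U j - locM l α pih U i) := by
    ext ℓ
    simp only [(hF ℓ _).fderiv, _root_.add_apply, _root_.sum_apply, _root_.smul_apply,
      _root_.sub_apply, smul_eq_mul, ContinuousLinearMap.proj_apply, Finset.sum_add_distrib,
      Pi.add_apply, Finset.sum_apply, Pi.smul_apply, dotProduct]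
    rw [add_comm]
    congr 1
    · simp [← Finset.mul_sum, Finset.sum_add_distrib, Pi.single_apply]
      ring
    · rw [Finset.sum_comm]
      refine Finset.sum_congr rfl fun j _ => ?_
      rw [Finset.mul_sum, Finset.sum_mul]
      refine Finset.sum_congr rfl fun m _ => ?_
      simp only [Pi.sub_apply, Finset.sum_apply, Pi.smul_apply, smul_eq_mul]
      ring
  rw [hdiv, key]
  simp only [locC]
  abel
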